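/- arXiv:1609.06999 — 6 statements merged into one kernel-verified Lean document; each statement's English description precedes it below -/
import Mathlib

section
/- Let k ∈ ℤ and let f : ℍ → ℂ be smooth with Δ_k f = 0. Then for every integer r ≥ 1, R_{k−2r}(L_k^r f) = −(r−1)(r−k) · L_k^{r−1} f. In particular, R_{k−2}(L_k f) = 0. -/
open Complex

noncomputable section

/-- The upper half-plane, as a subset of `ℂ`. -/
def UH : Set ℂ := {z : ℂ | 0 < z.im}

/-- Partial derivative in the direction of the real axis, `∂f/∂u`. -/
noncomputable def du (f : ℂ → ℂ) (z : ℂ) : ℂ := fderiv ℝ f z 1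

/-- Partial derivative in the direction of the imaginary axis, `∂f/∂v`. -/
noncomputable def dv (f : ℂ → ℂ) (z : ℂ) : ℂ := fderiv ℝ f z Complex.I

/-- The Wirtinger derivative `∂_τ f = (1/2)(∂f/∂u − i ∂f/∂v)`. -/
noncomputable def dtau (f : ℂ → ℂ) (z : ℂ) : ℂ :=
  (1 / 2) * (du f z - Complex.I * dv f z)

/-- The Wirtinger derivative `∂_τ̄ f = (1/2)(∂f/∂u + i ∂f/∂v)`. -/
noncomputable def dtauBar (f : ℂ → ℂ) (z : ℂ) : ℂ :=
  (1 / 2) * (du f z + Complex.I * dv f z)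

/-- The Maass raising operator `R_k f = 2i ∂_τ f + (k/v) f`. -/
noncomputable def Rop (k : ℤ) (f : ℂ → ℂ) (z : ℂ) : ℂ :=
  2 * Complex.I * dtau f z + ((k : ℂ) / (z.im : ℂ)) * f z

/-- The Maass lowering operator `L_k f = −2i v² ∂_τ̄ f`. -/
noncomputable def Lop (_k : ℤ) (f : ℂ → ℂ) (z : ℂ) : ℂ :=
  -2 * Complex.I * (z.im : ℂ) ^ 2 * dtauBar f z

/-- The weight-`k` hyperbolic Laplacian
`Δ_k f = −v²(∂²f/∂u² + ∂²f/∂v²) + i k v (∂f/∂u + i ∂f/∂v)`. -/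
noncomputable def Lap (k : ℤ) (f : ℂ → ℂ) (z : ℂ) : ℂ :=
  -(z.im : ℂ) ^ 2 * (du (du f) z + dv (dv f) z)
    + Complex.I * (k : ℂ) * (z.im : ℂ) * (du f z + Complex.I * dv f z)

/-- Iterated raising operator `R_k^r = R_{k+2(r−1)} ∘ ⋯ ∘ R_{k+2} ∘ R_k`, `R_k^0 = id`. -/
noncomputable def Riter (k : ℤ) : ℕ → (ℂ → ℂ) → ℂ → ℂ
  | 0, f => f
  | r + 1, f => Rop (k + 2 * (r : ℤ)) (Riter k r f)

/-- Iterated lowering operator `L_k^r = L_{k−2(r−1)} ∘ ⋯ ∘ L_{k−2} ∘ L_k`, `L_k^0 = id`. -/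
noncomputable def Liter (k : ℤ) : ℕ → (ℂ → ℂ) → ℂ → ℂ
  | 0, f => f
  | r + 1, f => Lop (k - 2 * (r : ℤ)) (Liter k r f)

theorem isOpen_UH : IsOpen UH := isOpen_lt continuous_const continuous_im

theorem ContDiffOn.fderiv_apply_UH {g : ℂ → ℂ} (hg : ContDiffOn ℝ (⊤ : ℕ∞) g UH) (w : ℂ) :
    ContDiffOn ℝ (⊤ : ℕ∞) (fun z => fderiv ℝ g z w) UH :=
  (hg.fderiv_of_isOpen isOpen_UH (by simp)).clm_apply contDiffOn_const

theorem contDiffOn_du {g : ℂ → ℂ} (hg : ContDiffOn ℝ (⊤ : ℕ∞) g UH) :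
    ContDiffOn ℝ (⊤ : ℕ∞) (du g) UH :=
  hg.fderiv_apply_UH 1

theorem contDiffOn_dv {g : ℂ → ℂ} (hg : ContDiffOn ℝ (⊤ : ℕ∞) g UH) :
    ContDiffOn ℝ (⊤ : ℕ∞) (dv g) UH :=
  hg.fderiv_apply_UH I

theorem contDiff_ofReal_im : ContDiff ℝ (⊤ : ℕ∞) (fun z : ℂ => (z.im : ℂ)) :=
  (ofRealCLM.comp imCLM).contDiff

theorem hasFDerivAt_ofReal_im (z : ℂ) :
    HasFDerivAt (fun z : ℂ => (z.im : ℂ)) (ofRealCLM.comp imCLM) z :=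
  (ofRealCLM.comp imCLM).hasFDerivAt

theorem contDiffOn_Lop {g : ℂ → ℂ} (m : ℤ) (hg : ContDiffOn ℝ (⊤ : ℕ∞) g UH) :
    ContDiffOn ℝ (⊤ : ℕ∞) (Lop m g) UH :=
  (contDiffOn_const.mul (contDiff_ofReal_im.contDiffOn.pow 2)).mul
    (contDiffOn_const.mul ((contDiffOn_du hg).add (contDiffOn_const.mul (contDiffOn_dv hg))))

theorem contDiffOn_Liter {f : ℂ → ℂ} (k : ℤ) (hf : ContDiffOn ℝ (⊤ : ℕ∞) f UH) (r : ℕ) :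
    ContDiffOn ℝ (⊤ : ℕ∞) (Liter k r f) UH := by
  induction r with
  | zero => exact hf
  | succ r ih => exact contDiffOn_Lop _ ih

theorem hasFDerivAt_of_contDiffOn_UH {g : ℂ → ℂ} (hg : ContDiffOn ℝ (⊤ : ℕ∞) g UH) {z : ℂ}
    (hz : z ∈ UH) : HasFDerivAt g (fderiv ℝ g z) z :=
  ((hg.contDiffAt (isOpen_UH.mem_nhds hz)).differentiableAt (by simp)).hasFDerivAt

theorem du_dv_comm {g : ℂ → ℂ} (hg : ContDiffOn ℝ (⊤ : ℕ∞) g UH) {z : ℂ} (hz : z ∈ UH) :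
    du (dv g) z = dv (du g) z := by
  have hgz := hg.contDiffAt (isOpen_UH.mem_nhds hz)
  have hd : DifferentiableAt ℝ (fderiv ℝ g) z :=
    (hgz.fderiv_right (m := 1) (WithTop.coe_le_coe.mpr le_top)).differentiableAt (by simp)
  have hsymm : IsSymmSndFDerivAt ℝ g z :=
    hgz.isSymmSndFDerivAt
      (minSmoothness_of_isRCLikeNormedField.trans_le (WithTop.coe_le_coe.mpr le_top))
  have happ (w : ℂ) : fderiv ℝ (fun y => fderiv ℝ g y w) z = (fderiv ℝ (fderiv ℝ g) z).flip w := by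
    rw [fderiv_clm_apply hd (differentiableAt_const w)]
    simp
  change fderiv ℝ (fun y => fderiv ℝ g y I) z 1 = fderiv ℝ (fun y => fderiv ℝ g y 1) z I
  rw [happ, happ]
  exact hsymm.eq 1 I

theorem fderiv_Lop_apply {g : ℂ → ℂ} (m : ℤ) (hg : ContDiffOn ℝ (⊤ : ℕ∞) g UH) {z : ℂ}
    (hz : z ∈ UH) (w : ℂ) :
    fderiv ℝ (Lop m g) z w = -I * (2 * z.im * w.im * (du g z + I * dv g z)
      + (z.im : ℂ) ^ 2 * (fderiv ℝ (du g) z w + I * fderiv ℝ (dv g) z w)) := by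
  have hu := hasFDerivAt_of_contDiffOn_UH (contDiffOn_du hg) hz
  have hv := hasFDerivAt_of_contDiffOn_UH (contDiffOn_dv hg) hz
  have h : HasFDerivAt (Lop m g) _ z :=
    (((hasFDerivAt_ofReal_im z).pow 2).const_mul (-2 * I)).mul
      ((hu.add (hv.const_mul I)).const_mul (1 / 2))
  rw [h.fderiv]
  simp [dtauBar]
  ring

theorem fderiv_Rop_apply {g : ℂ → ℂ} (m : ℤ) (hg : ContDiffOn ℝ (⊤ : ℕ∞) g UH) {z : ℂ}
    (hz : z ∈ UH) (w : ℂ) :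
    fderiv ℝ (Rop m g) z w = I * (fderiv ℝ (du g) z w - I * fderiv ℝ (dv g) z w)
      + m * (fderiv ℝ g z w / z.im - w.im / (z.im : ℂ) ^ 2 * g z) := by
  have hz0 : (z.im : ℂ) ≠ 0 := ofReal_ne_zero.mpr (ne_of_gt hz)
  have hu := hasFDerivAt_of_contDiffOn_UH (contDiffOn_du hg) hz
  have hv := hasFDerivAt_of_contDiffOn_UH (contDiffOn_dv hg) hz
  have hinv : HasFDerivAt (fun y : ℂ => ((y.im : ℂ))⁻¹) _ z :=
    ((hasDerivAt_inv hz0).hasFDerivAt.restrictScalars ℝ).comp z (hasFDerivAt_ofReal_im z)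
  have h : HasFDerivAt (Rop m g) _ z :=
    (((hu.sub (hv.const_mul I)).const_mul (1 / 2)).const_mul (2 * I)).add
      ((hinv.const_mul (m : ℂ)).mul (hasFDerivAt_of_contDiffOn_UH hg hz))
  rw [h.fderiv]
  simp
  field_simp
  ring

theorem Rop_Lop {g : ℂ → ℂ} (m : ℤ) (hg : ContDiffOn ℝ (⊤ : ℕ∞) g UH) {z : ℂ} (hz : z ∈ UH) :
    Rop (m - 2) (Lop m g) z = -Lap m g z := by
  have hz0 : (z.im : ℂ) ≠ 0 := ofReal_ne_zero.mpr (ne_of_gt hz)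
  have hcomm := du_dv_comm hg hz
  have h1 := fderiv_Lop_apply m hg hz 1
  have h2 := fderiv_Lop_apply m hg hz I
  simp only [← du.eq_def, ← dv.eq_def, one_im, I_im] at h1 h2
  rw [Rop, dtau, h1, h2, hcomm, Lop, dtauBar, Lap]
  push_cast
  field_simp
  ring_nf
  simp only [I_sq, I_pow_three, I_pow_four]
  ring

theorem Lop_Rop {g : ℂ → ℂ} (n m : ℤ) (hg : ContDiffOn ℝ (⊤ : ℕ∞) g UH) {z : ℂ} (hz : z ∈ UH) :
    Lop n (Rop m g) z = -Lap m g z - m * g z := by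
  have hz0 : (z.im : ℂ) ≠ 0 := ofReal_ne_zero.mpr (ne_of_gt hz)
  have hcomm := du_dv_comm hg hz
  have h1 := fderiv_Rop_apply m hg hz 1
  have h2 := fderiv_Rop_apply m hg hz I
  simp only [← du.eq_def, ← dv.eq_def, one_im, I_im] at h1 h2
  rw [Lop, dtauBar, h1, h2, hcomm, Lap]
  push_cast
  field_simp
  ring_nf
  simp only [I_sq, I_pow_four]
  ring

theorem Rop_Lop_eq_Lop_Rop_add {g : ℂ → ℂ} (n m : ℤ) (hg : ContDiffOn ℝ (⊤ : ℕ∞) g UH) {z : ℂ}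
    (hz : z ∈ UH) : Rop (m - 2) (Lop m g) z = Lop n (Rop m g) z + m * g z := by
  rw [Rop_Lop m hg hz, Lop_Rop n m hg hz]
  ring

theorem Lop_congr (n : ℤ) {g h : ℂ → ℂ} (hgh : Set.EqOn g h UH) {z : ℂ} (hz : z ∈ UH) :
    Lop n g z = Lop n h z := by
  have h := (hgh.eventuallyEq_of_mem (isOpen_UH.mem_nhds hz)).fderiv_eq (𝕜 := ℝ)
  simp only [Lop, dtauBar, du, dv, h]

theorem Lop_const_mul (n : ℤ) (c : ℂ) {g : ℂ → ℂ} (hg : ContDiffOn ℝ (⊤ : ℕ∞) g UH) {z : ℂ}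
    (hz : z ∈ UH) : Lop n (fun y => c * g y) z = c * Lop n g z := by
  have h := ((hasFDerivAt_of_contDiffOn_UH hg hz).const_mul c).fderiv
  simp only [Lop, dtauBar, du, dv, h, smul_apply, smul_eq_mul]
  ring

theorem Rop_Liter_succ {k : ℤ} {f : ℂ → ℂ} (hf : ContDiffOn ℝ (⊤ : ℕ∞) f UH)
    (hharm : ∀ z ∈ UH, Lap k f z = 0) (s : ℕ) :
    ∀ z ∈ UH, Rop (k - 2 * ((s : ℤ) + 1)) (Liter k (s + 1) f) z
      = -((s : ℂ) * ((s : ℂ) + 1 - (k : ℂ))) * Liter k s f z := by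
  induction s with
  | zero =>
    intro z hz
    simpa [Liter, hharm z hz] using Rop_Lop k hf hz
  | succ s ih =>
    intro z hz
    have hstep := Rop_Lop_eq_Lop_Rop_add (k - 2 * (s : ℤ)) (k - 2 * ((s : ℤ) + 1))
      (contDiffOn_Liter k hf (s + 1)) hz
    rw [Lop_congr _ ih hz, Lop_const_mul _ _ (contDiffOn_Liter k hf s) hz] at hstep
    change _ = _ * Liter k (s + 1) f z + _ at hstep
    have hL : Liter k (s + 1 + 1) f = Lop (k - 2 * ((s : ℤ) + 1)) (Liter k (s + 1) f) := by
      simp [Liter]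
    have hw : k - 2 * (((s + 1 : ℕ) : ℤ) + 1) = k - 2 * ((s : ℤ) + 1) - 2 := by
      push_cast
      ring
    rw [hw, hL, hstep]
    push_cast
    ring

/-- if `Δ_k f = 0` then `R_{k−2r}(L_k^r f) = −(r−1)(r−k) L_k^{r−1} f`
for every `r ≥ 1`; in particular `R_{k−2}(L_k f) = 0`. -/
theorem stmt2 (k : ℤ) (f : ℂ → ℂ) (hf : ContDiffOn ℝ (⊤ : ℕ∞) f UH)
    (hharm : ∀ z ∈ UH, Lap k f z = 0) :
    (∀ r : ℕ, 1 ≤ r → ∀ z ∈ UH,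
      Rop (k - 2 * (r : ℤ)) (Liter k r f) z
        = -(((r : ℂ) - 1) * ((r : ℂ) - (k : ℂ))) * Liter k (r - 1) f z) ∧
    (∀ z ∈ UH, Rop (k - 2) (Lop k f) z = 0) := by
  refine ⟨fun r hr z hz => ?_, fun z hz => by rw [Rop_Lop k hf hz, hharm z hz, neg_zero]⟩
  obtain ⟨s, rfl⟩ := Nat.exists_eq_add_of_le' hr
  have h := Rop_Liter_succ hf hharm s z hz
  rw [Nat.add_sub_cancel]
  push_cast
  rw [h, add_sub_cancel_right]
end
end

section
/- (Bol's identity as an operator identity.) Let k ∈ ℤ with k ≤ 0. For every smooth function f : ℍ → ℂ, D^{1−k} f = (−4π)^{k−1} · R_k^{1−k} f, where D^{1−k} is the (1−k)-fold iterate of D f = (1/(2πi)) ∂_τ f. -/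
open Complex

noncomputable section

/-- The operator `D f = (1/(2πi)) ∂_τ f`. -/
noncomputable def Dop (f : ℂ → ℂ) (z : ℂ) : ℂ :=
  (1 / (2 * (Real.pi : ℂ) * Complex.I)) * dtau f z

/-- The `n`-fold iterate `D^n`. -/
noncomputable def Diter : ℕ → (ℂ → ℂ) → ℂ → ℂ
  | 0, f => f
  | n + 1, f => Dop (Diter n f)

/-- The operator `2i ∂_τ`, normalized so that it maps `v` to `1`. -/
def del (f : ℂ → ℂ) (z : ℂ) : ℂ := 2 * I * dtau f z

theorem del_eq (f : ℂ → ℂ) (z : ℂ) : del f z = I * fderiv ℝ f z 1 + fderiv ℝ f z I := by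
  simp only [del, dtau, du, dv]
  linear_combination (-fderiv ℝ f z I) * I_sq

theorem im_ne_zero_of_mem_UH {z : ℂ} (hz : z ∈ UH) : (z.im : ℂ) ≠ 0 :=
  ofReal_ne_zero.mpr (ne_of_gt hz)

theorem differentiableAt_of_contDiffOn_UH {f : ℂ → ℂ} (hf : ContDiffOn ℝ (⊤ : ℕ∞) f UH) {z : ℂ}
    (hz : z ∈ UH) : DifferentiableAt ℝ f z :=
  (hf.differentiableOn (by simp)).differentiableAt (isOpen_UH.mem_nhds hz)

theorem del_congr {f g : ℂ → ℂ} (h : Set.EqOn f g UH) : Set.EqOn (del f) (del g) UH := by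
  intro z hz
  have : f =ᶠ[nhds z] g := h.eventuallyEq_of_mem (isOpen_UH.mem_nhds hz)
  simp only [del_eq, this.fderiv_eq]

theorem iterate_del_congr {f g : ℂ → ℂ} (h : Set.EqOn f g UH) (n : ℕ) :
    Set.EqOn (del^[n] f) (del^[n] g) UH := by
  induction n with
  | zero => exact h
  | succ n ih => simpa only [Function.iterate_succ_apply'] using del_congr ih

theorem contDiffOn_del {f : ℂ → ℂ} (hf : ContDiffOn ℝ (⊤ : ℕ∞) f UH) :
    ContDiffOn ℝ (⊤ : ℕ∞) (del f) UH := by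
  have h : ContDiffOn ℝ (⊤ : ℕ∞) (fderiv ℝ f) UH :=
    hf.fderiv_of_isOpen isOpen_UH (by simp)
  have h2 : ContDiffOn ℝ (⊤ : ℕ∞) (fun z => I * fderiv ℝ f z 1 + fderiv ℝ f z I) UH :=
    (contDiffOn_const.mul (h.clm_apply contDiffOn_const)).add (h.clm_apply contDiffOn_const)
  exact h2.congr fun z _ => del_eq f z

theorem contDiffOn_iterate_del {f : ℂ → ℂ} (hf : ContDiffOn ℝ (⊤ : ℕ∞) f UH) (n : ℕ) :
    ContDiffOn ℝ (⊤ : ℕ∞) (del^[n] f) UH := by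
  induction n with
  | zero => exact hf
  | succ n ih => simpa only [Function.iterate_succ_apply'] using contDiffOn_del ih

theorem del_add {f g : ℂ → ℂ} {z : ℂ} (hf : DifferentiableAt ℝ f z)
    (hg : DifferentiableAt ℝ g z) : del (fun w => f w + g w) z = del f z + del g z := by
  simp only [del_eq, fderiv_fun_add hf hg, _root_.add_apply]
  ring

theorem del_const_mul (c : ℂ) {f : ℂ → ℂ} {z : ℂ} (hf : DifferentiableAt ℝ f z) :
    del (fun w => c * f w) z = c * del f z := by
  simp only [del_eq, fderiv_const_mul hf c, _root_.smul_apply, smul_eq_mul]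
  ring

theorem contDiffOn_im_zpow (m : ℤ) : ContDiffOn ℝ (⊤ : ℕ∞) (fun z : ℂ => (z.im : ℂ) ^ m) UH := by
  have him : ContDiff ℝ (⊤ : ℕ∞) (fun z : ℂ => (z.im : ℂ)) :=
    (ofRealCLM.comp imCLM).contDiff
  cases m with
  | ofNat n => simpa using (him.pow n).contDiffOn
  | negSucc n =>
    simp only [zpow_negSucc]
    exact (him.pow (n + 1)).contDiffOn.inv fun z hz => pow_ne_zero _ (im_ne_zero_of_mem_UH hz)

theorem contDiffOn_im_zpow_mul {f : ℂ → ℂ} (hf : ContDiffOn ℝ (⊤ : ℕ∞) f UH) (m : ℤ) :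
    ContDiffOn ℝ (⊤ : ℕ∞) (fun z => (z.im : ℂ) ^ m * f z) UH :=
  (contDiffOn_im_zpow m).mul hf

theorem del_im_zpow_mul (m : ℤ) {f : ℂ → ℂ} {z : ℂ} (hz : z ∈ UH)
    (hf : DifferentiableAt ℝ f z) :
    del (fun w => (w.im : ℂ) ^ m * f w) z =
      (z.im : ℂ) ^ m * del f z + m * (z.im : ℂ) ^ (m - 1) * f z := by
  have him : HasFDerivAt (fun w : ℂ => w.im) imCLM z := imCLM.hasFDerivAt
  have hpow := ofRealCLM.hasFDerivAt.comp z
    ((hasDerivAt_zpow m z.im (Or.inl (ne_of_gt hz))).comp_hasFDerivAt z him)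
  have hmul := hpow.mul hf.hasFDerivAt
  have heq : (fun w : ℂ => (w.im : ℂ) ^ m * f w) =
      ((⇑ofRealCLM ∘ (fun x : ℝ => x ^ m) ∘ fun w : ℂ => w.im) * f) := by
    ext w
    simp
  rw [del_eq, del_eq, heq, hmul.fderiv]
  simp
  ring

theorem del_im_mul {f : ℂ → ℂ} {z : ℂ} (hz : z ∈ UH) (hf : DifferentiableAt ℝ f z) :
    del (fun w => (w.im : ℂ) * f w) z = (z.im : ℂ) * del f z + f z := by
  simpa using del_im_zpow_mul 1 hz hf

/-- The Leibniz rule for the iterates of `2i ∂_τ` on a product with `v`. -/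
theorem iterate_del_im_mul {f : ℂ → ℂ} (hf : ContDiffOn ℝ (⊤ : ℕ∞) f UH) (n : ℕ) {z : ℂ}
    (hz : z ∈ UH) :
    del^[n + 1] (fun w => (w.im : ℂ) * f w) z =
      (z.im : ℂ) * del^[n + 1] f z + (n + 1) * del^[n] f z := by
  induction n generalizing z with
  | zero => simpa using del_im_mul hz (differentiableAt_of_contDiffOn_UH hf hz)
  | succ n ih =>
    have hn := differentiableAt_of_contDiffOn_UH (contDiffOn_iterate_del hf n) hz
    have hn1 := differentiableAt_of_contDiffOn_UH (contDiffOn_iterate_del hf (n + 1)) hz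
    have hmul : DifferentiableAt ℝ (fun w : ℂ => (w.im : ℂ) * del^[n + 1] f w) z :=
      (ofRealCLM.comp imCLM).differentiableAt.mul hn1
    rw [Function.iterate_succ_apply' del (n + 1), del_congr (fun w hw => ih hw) hz,
      del_add hmul (hn.const_mul _), del_im_mul hz hn1, del_const_mul _ hn,
      ← Function.iterate_succ_apply' del, ← Function.iterate_succ_apply' del]
    push_cast
    ring

theorem Rop_eq (k : ℤ) (f : ℂ → ℂ) (z : ℂ) :
    Rop k f z = del f z + (k : ℂ) / (z.im : ℂ) * f z := rfl

theorem Rop_congr (k : ℤ) {f g : ℂ → ℂ} (h : Set.EqOn f g UH) :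
    Set.EqOn (Rop k f) (Rop k g) UH := by
  intro z hz
  rw [Rop_eq, Rop_eq, del_congr h hz, h hz]

/-- `R_k^r f = v^{1-k-r} (2i ∂_τ)^r (v^{k+r-1} f)`. -/
theorem Riter_eq (k : ℤ) (r : ℕ) {f : ℂ → ℂ} (hf : ContDiffOn ℝ (⊤ : ℕ∞) f UH) {z : ℂ}
    (hz : z ∈ UH) :
    Riter k r f z =
      (z.im : ℂ) ^ (1 - k - r) * del^[r] (fun w => (w.im : ℂ) ^ (k + r - 1) * f w) z := by
  induction r generalizing z with
  | zero =>
    have hv := im_ne_zero_of_mem_UH hz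
    simp [Riter, ← mul_assoc, ← zpow_add₀ hv]
  | succ r ih =>
    have hv := im_ne_zero_of_mem_UH hz
    have hg := contDiffOn_im_zpow_mul hf (k + r - 1)
    have hshift : Set.EqOn (fun w : ℂ => (w.im : ℂ) ^ (k + (r + 1 : ℕ) - 1) * f w)
        (fun w => (w.im : ℂ) * ((w.im : ℂ) ^ (k + r - 1) * f w)) UH := by
      intro w hw
      have hexp : k + ((r + 1 : ℕ) : ℤ) - 1 = 1 + (k + r - 1) := by
        push_cast
        ring
      simp only [hexp, zpow_one_add₀ (im_ne_zero_of_mem_UH hw), mul_assoc]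
    rw [iterate_del_congr hshift _ hz, iterate_del_im_mul hg r hz, Riter,
      Rop_congr _ (fun w hw => ih hw) hz, Rop_eq,
      del_im_zpow_mul _ hz
        (differentiableAt_of_contDiffOn_UH (contDiffOn_iterate_del hg r) hz),
      ← Function.iterate_succ_apply' del]
    have h1 : (z.im : ℂ) ^ (1 - k - r) = (z.im : ℂ) * (z.im : ℂ) ^ (1 - k - ((r + 1 : ℕ) : ℤ)) := by
      rw [← zpow_one_add₀ hv]
      congr 1
      push_cast
      ring
    have h2 : 1 - k - (r : ℤ) - 1 = 1 - k - ((r + 1 : ℕ) : ℤ) := by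
      push_cast
      ring
    rw [h2, h1]
    field_simp
    push_cast
    ring

theorem Diter_eq (n : ℕ) {f : ℂ → ℂ} (hf : ContDiffOn ℝ (⊤ : ℕ∞) f UH) {z : ℂ} (hz : z ∈ UH) :
    Diter n f z = ((-4 * (Real.pi : ℂ)) ^ n)⁻¹ * del^[n] f z := by
  induction n generalizing z with
  | zero => simp [Diter]
  | succ n ih =>
    have hpi : (Real.pi : ℂ) ≠ 0 := ofReal_ne_zero.mpr Real.pi_ne_zero
    have hD : ∀ g : ℂ → ℂ, Dop g z = (-4 * (Real.pi : ℂ))⁻¹ * del g z := by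
      intro g
      simp only [Dop, del]
      field_simp
      linear_combination (4 * dtau g z) * I_sq
    rw [Diter, hD, del_congr (fun w hw => ih hw) hz,
      del_const_mul _ (differentiableAt_of_contDiffOn_UH (contDiffOn_iterate_del hf n) hz),
      ← Function.iterate_succ_apply' del, pow_succ', mul_inv (-4 * (Real.pi : ℂ)), mul_assoc _⁻¹]

/-- Bol's identity: for `k ≤ 0` and every smooth `f`,
`D^{1−k} f = (−4π)^{k−1} R_k^{1−k} f`. -/
theorem stmt5 (k : ℤ) (hk : k ≤ 0) (f : ℂ → ℂ) (hf : ContDiffOn ℝ (⊤ : ℕ∞) f UH) :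
    ∀ z ∈ UH,
      Diter (1 - k).toNat f z
        = (-4 * (Real.pi : ℂ)) ^ (k - 1) * Riter k (1 - k).toNat f z := by
  intro z hz
  obtain ⟨n, hn⟩ := Int.eq_ofNat_of_zero_le (show 0 ≤ 1 - k by omega)
  obtain rfl : k = 1 - n := by omega
  rw [hn, Int.toNat_natCast, Diter_eq n hf hz, Riter_eq _ n hf hz]
  simp
end
end

section
/- Let k ∈ ℤ, let Γ be a subgroup of SL₂(ℝ), and let f : ℍ → ℂ be smooth with Δ_k f = 0 and f(γτ) = (cτ+d)^k f(τ) for all γ = [[a,b],[c,d]] ∈ Γ and all τ ∈ ℍ. Then ξ_k f is holomorphic on ℍ and satisfies (ξ_k f)(γτ) = (cτ+d)^{2−k} (ξ_k f)(τ) for all γ ∈ Γ and τ ∈ ℍ. -/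
open Complex

noncomputable section

/-- The Bruinier–Funke operator `ξ_k f = 2i v^k ⋅ conj(∂_τ̄ f)`. -/
noncomputable def xiop (k : ℤ) (f : ℂ → ℂ) (z : ℂ) : ℂ :=
  2 * Complex.I * (z.im : ℂ) ^ k * (starRingEnd ℂ) (dtauBar f z)

/-- Möbius action of `SL₂(ℝ)`: `γτ = (aτ+b)/(cτ+d)`. -/
noncomputable def moeb (g : Matrix.SpecialLinearGroup (Fin 2) ℝ) (z : ℂ) : ℂ :=
  ((g.1 0 0 : ℂ) * z + (g.1 0 1 : ℂ)) / ((g.1 1 0 : ℂ) * z + (g.1 1 1 : ℂ))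

theorem HasFDerivAt.dtauBar_eq {f : ℂ → ℂ} {L : ℂ →L[ℝ] ℂ} {z : ℂ} (h : HasFDerivAt f L z) :
    dtauBar f z = (1 / 2) * (L 1 + I * L I) := by
  simp only [dtauBar, du, dv, h.fderiv]

theorem Filter.EventuallyEq.dtauBar_eq {f g : ℂ → ℂ} {z : ℂ} (h : f =ᶠ[nhds z] g) :
    dtauBar f z = dtauBar g z := by
  simp only [dtauBar, du, dv, h.fderiv_eq]

theorem ContinuousLinearMap.apply_add_I_mul_apply_mul_I (L : ℂ →L[ℝ] ℂ) (w : ℂ) :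
    L w + I * L (w * I) = (starRingEnd ℂ) w * (L 1 + I * L I) := by
  have key : ∀ x y : ℝ, L (x + y * I) = x * L 1 + y * L I := fun x y => by
    have h : (x + y * I : ℂ) = x • (1 : ℂ) + y • I := by simp
    rw [h, map_add, map_smul, map_smul, real_smul, real_smul]
  have h1 : L w = w.re * L 1 + w.im * L I := by
    rw [← key, re_add_im]
  have h2 : L (w * I) = (-w.im : ℝ) * L 1 + w.re * L I := by
    rw [← key]
    congr 1
    apply Complex.ext <;> simp
  have h3 : (starRingEnd ℂ) w = w.re - w.im * I := by
    apply Complex.ext <;> simp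
  rw [h1, h2, h3]
  push_cast
  linear_combination (w.im * L I) * I_sq

/-- Chain rule for `∂_τ̄` and a holomorphic inner function. -/
theorem dtauBar_comp {f m : ℂ → ℂ} {m' z : ℂ} (hf : DifferentiableAt ℝ f (m z))
    (hm : HasDerivAt m m' z) :
    dtauBar (fun w => f (m w)) z = (starRingEnd ℂ) m' * dtauBar f (m z) := by
  have h := hf.hasFDerivAt.comp z hm.complexToReal_fderiv
  rw [HasFDerivAt.dtauBar_eq (f := fun w => f (m w)) h, hf.hasFDerivAt.dtauBar_eq]
  have := (fderiv ℝ f (m z)).apply_add_I_mul_apply_mul_I m'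
  simp only [ContinuousLinearMap.comp_apply, smul_apply,
    one_apply_eq_self, smul_eq_mul, mul_one]
  rw [this]
  ring

/-- The operator `∂_τ̄` is linear over holomorphic functions. -/
theorem dtauBar_mul {f h : ℂ → ℂ} {h' z : ℂ} (hh : HasDerivAt h h' z)
    (hf : DifferentiableAt ℝ f z) :
    dtauBar (fun w => h w * f w) z = h z * dtauBar f z := by
  have H := hh.complexToReal_fderiv.mul hf.hasFDerivAt
  rw [HasFDerivAt.dtauBar_eq (f := fun w => h w * f w) H, hf.hasFDerivAt.dtauBar_eq]
  simp only [add_apply, smul_apply,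
    one_apply_eq_self, smul_eq_mul, mul_one]
  linear_combination (1 / 2 * f z * h') * I_sq

theorem denom_ne_zero (γ : Matrix.SpecialLinearGroup (Fin 2) ℝ) {z : ℂ} (hz : z ∈ UH) :
    (γ.1 1 0 : ℂ) * z + (γ.1 1 1 : ℂ) ≠ 0 := by
  intro h
  have hz' : z.im ≠ 0 := ne_of_gt hz
  have him := congrArg Complex.im h
  have hre := congrArg Complex.re h
  simp [hz'] at him
  simp [him] at hre
  have hdet := γ.2
  rw [Matrix.det_fin_two] at hdet
  simp [him, hre] at hdet

theorem im_moeb (γ : Matrix.SpecialLinearGroup (Fin 2) ℝ) (z : ℂ) :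
    (moeb γ z).im = z.im / normSq ((γ.1 1 0 : ℂ) * z + (γ.1 1 1 : ℂ)) := by
  have hdet := γ.2
  rw [Matrix.det_fin_two] at hdet
  rw [moeb, div_im, ← sub_div]
  congr 1
  simp
  linear_combination z.im * hdet

theorem moeb_mem_UH (γ : Matrix.SpecialLinearGroup (Fin 2) ℝ) {z : ℂ} (hz : z ∈ UH) :
    moeb γ z ∈ UH := by
  show 0 < (moeb γ z).im
  rw [im_moeb]
  exact div_pos hz (normSq_pos.2 (denom_ne_zero γ hz))

theorem hasDerivAt_moeb (γ : Matrix.SpecialLinearGroup (Fin 2) ℝ) {z : ℂ} (hz : z ∈ UH) :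
    HasDerivAt (moeb γ) (1 / ((γ.1 1 0 : ℂ) * z + (γ.1 1 1 : ℂ)) ^ 2) z := by
  have hdet : (γ.1 0 0 : ℂ) * γ.1 1 1 - γ.1 0 1 * γ.1 1 0 = 1 := by
    have := γ.2
    rw [Matrix.det_fin_two] at this
    exact_mod_cast this
  have hlin (a b : ℂ) : HasDerivAt (fun w : ℂ => a * w + b) a z := by
    simpa using ((hasDerivAt_id z).const_mul a).add_const b
  refine ((hlin _ _).div (hlin _ _) (denom_ne_zero γ hz)).congr_deriv ?_
  congr 1
  linear_combination hdet

theorem xiop_moeb {k : ℤ} {f : ℂ → ℂ} (hf : DifferentiableOn ℝ f UH)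
    {γ : Matrix.SpecialLinearGroup (Fin 2) ℝ}
    (htrans : ∀ z ∈ UH, f (moeb γ z) = ((γ.1 1 0 : ℂ) * z + (γ.1 1 1 : ℂ)) ^ k * f z)
    {z : ℂ} (hz : z ∈ UH) :
    xiop k f (moeb γ z) = ((γ.1 1 0 : ℂ) * z + (γ.1 1 1 : ℂ)) ^ (2 - k) * xiop k f z := by
  have hfd : ∀ w ∈ UH, DifferentiableAt ℝ f w := fun w hw =>
    hf.differentiableAt (isOpen_UH.mem_nhds hw)
  have hj := denom_ne_zero γ hz
  have hlin : HasDerivAt (fun w : ℂ => (γ.1 1 0 : ℂ) * w + (γ.1 1 1 : ℂ)) (γ.1 1 0 : ℂ) z := by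
    simpa using ((hasDerivAt_id z).const_mul (γ.1 1 0 : ℂ)).add_const (γ.1 1 1 : ℂ)
  have hpow := (hasDerivAt_zpow k _ (Or.inl hj)).comp z hlin
  have heq : (fun w => f (moeb γ w)) =ᶠ[nhds z]
      fun w => ((γ.1 1 0 : ℂ) * w + (γ.1 1 1 : ℂ)) ^ k * f w :=
    Filter.eventuallyEq_of_mem (isOpen_UH.mem_nhds hz) htrans
  have key := heq.dtauBar_eq
  rw [dtauBar_comp (hfd _ (moeb_mem_UH γ hz)) (hasDerivAt_moeb γ hz),
    dtauBar_mul (h := fun w => ((γ.1 1 0 : ℂ) * w + (γ.1 1 1 : ℂ)) ^ k) hpow (hfd z hz)] at key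
  have key' := congrArg (starRingEnd ℂ) key
  rw [map_mul, conj_conj, map_mul, map_zpow₀] at key'
  simp only [xiop, im_moeb]
  set j := (γ.1 1 0 : ℂ) * z + (γ.1 1 1 : ℂ)
  have hjc : (starRingEnd ℂ) j ≠ 0 := (map_ne_zero _).2 hj
  have hbar : (starRingEnd ℂ) (dtauBar f (moeb γ z)) =
      j ^ 2 * ((starRingEnd ℂ) j ^ k * (starRingEnd ℂ) (dtauBar f z)) := by
    rw [← key']
    field_simp
  rw [hbar, ofReal_div, ← mul_conj, div_zpow, mul_zpow, zpow_sub₀ hj]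
  have h1 := zpow_ne_zero k hj
  have h2 := zpow_ne_zero k hjc
  field_simp

theorem differentiableAt_xiop {k : ℤ} {f : ℂ → ℂ} {z : ℂ} (hf : ContDiffAt ℝ 2 f z)
    (hz : z.im ≠ 0) (hharm : Lap k f z = 0) : DifferentiableAt ℂ (xiop k f) z := by
  have hsymm : IsSymmSndFDerivAt ℝ f z := hf.isSymmSndFDerivAt (by simp)
  have hD : HasFDerivAt (fderiv ℝ f) (fderiv ℝ (fderiv ℝ f) z) z :=
    ((hf.fderiv_right (m := 1) (by norm_num)).differentiableAt one_ne_zero).hasFDerivAt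
  have hdir (w : ℂ) : HasFDerivAt (fun y => fderiv ℝ f y w)
      ((fderiv ℝ (fderiv ℝ f) z).flip w) z := by
    simpa using hD.clm_apply (hasFDerivAt_const w z)
  have hg : HasFDerivAt (dtauBar f) _ z :=
    (((hdir 1).add ((hdir I).const_mul I)).const_mul (1 / 2 : ℂ))
  have hgc := (conjCLE : ℂ →L[ℝ] ℂ).hasFDerivAt.comp z hg
  have hzc : (z.im : ℂ) ≠ 0 := ofReal_ne_zero.2 hz
  have him : HasFDerivAt (fun w : ℂ => (w.im : ℂ)) (ofRealCLM.comp imCLM) z :=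
    (ofRealCLM.comp imCLM).hasFDerivAt
  have hpow := (hasDerivAt_zpow k _ (Or.inl hzc)).complexToReal_fderiv.comp z him
  have hxi : HasFDerivAt (xiop k f) _ z := (hpow.const_mul (2 * I)).mul hgc
  rw [differentiableAt_complex_iff_differentiableAt_real]
  refine ⟨hxi.differentiableAt, ?_⟩
  have hxx : du (du f) z = fderiv ℝ (fderiv ℝ f) z 1 1 := by
    rw [du, show du f = fun y => fderiv ℝ f y 1 from rfl, (hdir 1).fderiv]; rfl
  have hyy : dv (dv f) z = fderiv ℝ (fderiv ℝ f) z I I := by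
    rw [dv, show dv f = fun y => fderiv ℝ f y I from rfl, (hdir I).fderiv]; rfl
  have hxy := hsymm 1 I
  rw [Lap, hxx, hyy] at hharm
  have hc := congrArg (starRingEnd ℂ) hharm
  rw [hxi.fderiv]
  simp [dtauBar, du, dv, hxy] at hc ⊢
  rw [zpow_sub_one₀ hzc]
  field_simp
  refine mul_left_cancel₀ hzc ?_
  linear_combination I * hc +
    ((k : ℂ) * z.im * ((starRingEnd ℂ) ((fderiv ℝ f z) 1)
        - I * (starRingEnd ℂ) ((fderiv ℝ f z) I))
      + (z.im : ℂ) ^ 2 * (starRingEnd ℂ) (fderiv ℝ (fderiv ℝ f) z I 1)) * I_sq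

/-- if `f` is smooth, harmonic of weight `k`, and transforms with weight `k`
under a subgroup `Γ ≤ SL₂(ℝ)`, then `ξ_k f` is holomorphic on the upper half-plane and
transforms with weight `2−k` under `Γ`. -/
theorem stmt7 (k : ℤ) (Γ : Subgroup (Matrix.SpecialLinearGroup (Fin 2) ℝ)) (f : ℂ → ℂ)
    (hf : ContDiffOn ℝ (⊤ : ℕ∞) f UH) (hharm : ∀ z ∈ UH, Lap k f z = 0)
    (htrans : ∀ γ ∈ Γ, ∀ z ∈ UH,
      f (moeb γ z) = ((γ.1 1 0 : ℂ) * z + (γ.1 1 1 : ℂ)) ^ k * f z) :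
    DifferentiableOn ℂ (xiop k f) UH ∧
    ∀ γ ∈ Γ, ∀ z ∈ UH,
      xiop k f (moeb γ z) = ((γ.1 1 0 : ℂ) * z + (γ.1 1 1 : ℂ)) ^ (2 - k) * xiop k f z := by
  have hat : ∀ z ∈ UH, ContDiffAt ℝ (⊤ : ℕ∞) f z := fun z hz =>
    hf.contDiffAt (isOpen_UH.mem_nhds hz)
  refine ⟨fun z hz => ?_, fun γ hγ z hz => ?_⟩
  · exact (differentiableAt_xiop ((hat z hz).of_le (WithTop.coe_le_coe.2 (le_top : (2 : ℕ∞) ≤ ⊤)))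
      (ne_of_gt hz) (hharm z hz)).differentiableWithinAt
  · exact xiop_moeb (hf.differentiableOn (by simp)) (htrans γ hγ) hz
end
end

section
/- Let k ∈ ℤ with k ≤ 0 and let f : ℍ → ℂ be smooth with Δ_k f = 0. Then D^{1−k}(𝔉_k f) = ((−k)!/(−4π)^{1−k}) · ξ_k f. In particular, if f is holomorphic on ℍ then D^{1−k}(𝔉_k f) = 0. -/
open Complex

noncomputable section

/-- The flipping operator `𝔉_k f = (v^{−k}/(−k)!) ⋅ conj(R_k^{−k} f)`, for `k ≤ 0`. -/
noncomputable def flipOp (k : ℤ) (f : ℂ → ℂ) (z : ℂ) : ℂ :=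
  ((z.im : ℂ) ^ (-k) / ((-k).toNat.factorial : ℂ)) *
    (starRingEnd ℂ) (Riter k (-k).toNat f z)

/-- The first-order operator `∂/∂v + c ∂/∂u`; `c = I` gives `2i ∂_τ`, and `c = -I` gives
`-2i ∂_τ̄`. -/
def wd (c : ℂ) (f : ℂ → ℂ) (z : ℂ) : ℂ := dv f z + c * du f z

/-- Smooth complex-valued functions on the upper half-plane. -/
abbrev SmoothUH (f : ℂ → ℂ) : Prop := ContDiffOn ℝ (⊤ : ℕ∞) f UH

/-- The imaginary part as a complex-valued function. -/
def imC (z : ℂ) : ℂ := (z.im : ℂ)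

theorem imC_ne_zero {z : ℂ} (hz : z ∈ UH) : imC z ≠ 0 :=
  Complex.ofReal_ne_zero.mpr (ne_of_gt hz)

theorem hasFDerivAt_imC (z : ℂ) :
    HasFDerivAt imC (Complex.ofRealCLM.comp Complex.imCLM) z :=
  (Complex.ofRealCLM.comp Complex.imCLM).hasFDerivAt

theorem smoothUH_imC : SmoothUH imC :=
  (Complex.ofRealCLM.comp Complex.imCLM).contDiff.contDiffOn

theorem SmoothUH.differentiableAt {f : ℂ → ℂ} (hf : SmoothUH f) {z : ℂ} (hz : z ∈ UH) :
    DifferentiableAt ℝ f z :=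
  (hf.contDiffAt (isOpen_UH.mem_nhds hz)).differentiableAt (by simp)

theorem SmoothUH.fderiv_apply {f : ℂ → ℂ} (hf : SmoothUH f) (w : ℂ) :
    SmoothUH fun z => fderiv ℝ f z w :=
  (hf.fderiv_of_isOpen isOpen_UH (by simp)).clm_apply contDiffOn_const

theorem SmoothUH.wd {f : ℂ → ℂ} (hf : SmoothUH f) (c : ℂ) : SmoothUH (wd c f) :=
  (hf.fderiv_apply Complex.I).add (contDiffOn_const.mul (hf.fderiv_apply 1))

theorem SmoothUH.conj {f : ℂ → ℂ} (hf : SmoothUH f) :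
    SmoothUH fun z => (starRingEnd ℂ) (f z) :=
  Complex.conjCLE.contDiff.comp_contDiffOn hf

theorem wd_congr (c : ℂ) {f g : ℂ → ℂ} (h : Set.EqOn f g UH) :
    Set.EqOn (wd c f) (wd c g) UH := by
  intro z hz
  have : f =ᶠ[nhds z] g := h.eventuallyEq_of_mem (isOpen_UH.mem_nhds hz)
  simp only [wd, du, dv, this.fderiv_eq]

theorem wd_add (c : ℂ) {f g : ℂ → ℂ} (hf : SmoothUH f) (hg : SmoothUH g) {z : ℂ} (hz : z ∈ UH) :
    wd c (fun w => f w + g w) z = wd c f z + wd c g z := by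
  simp only [wd, du, dv, fderiv_fun_add (hf.differentiableAt hz) (hg.differentiableAt hz),
    add_apply]
  ring

theorem wd_mul (c : ℂ) {f g : ℂ → ℂ} (hf : SmoothUH f) (hg : SmoothUH g) {z : ℂ} (hz : z ∈ UH) :
    wd c (fun w => f w * g w) z = wd c f z * g z + f z * wd c g z := by
  simp only [wd, du, dv, fderiv_fun_mul (hf.differentiableAt hz) (hg.differentiableAt hz),
    add_apply, smul_apply, smul_eq_mul]
  ring

theorem wd_const (c a z : ℂ) : wd c (fun _ => a) z = 0 := by
  simp [wd, du, dv]

theorem wd_const_mul (c a : ℂ) {f : ℂ → ℂ} (hf : SmoothUH f) {z : ℂ} (hz : z ∈ UH) :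
    wd c (fun w => a * f w) z = a * wd c f z := by
  rw [wd_mul c contDiffOn_const hf hz, wd_const]
  ring

theorem wd_imC (c z : ℂ) : wd c imC z = 1 := by
  simp [wd, du, dv, (hasFDerivAt_imC z).fderiv]

theorem wd_imC_pow (c : ℂ) (n : ℕ) {z : ℂ} (hz : z ∈ UH) :
    wd c (fun w => imC w ^ (n + 1)) z = (n + 1) * imC z ^ n := by
  induction n with
  | zero => simpa using wd_imC c z
  | succ n ih =>
    have := wd_mul c (smoothUH_imC.pow (n + 1)) smoothUH_imC hz
    simp only [← pow_succ] at this
    rw [this, ih, wd_imC]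
    push_cast
    ring

theorem fderiv_fderiv_apply {f : ℂ → ℂ} (hf : SmoothUH f) {z : ℂ} (hz : z ∈ UH) (a b : ℂ) :
    fderiv ℝ (fun w => fderiv ℝ f w a) z b = fderiv ℝ (fderiv ℝ f) z b a := by
  have h : DifferentiableAt ℝ (fderiv ℝ f) z :=
    ((hf.fderiv_of_isOpen isOpen_UH (m := 1) (by norm_cast)).contDiffAt
      (isOpen_UH.mem_nhds hz)).differentiableAt (by simp)
  rw [fderiv_clm_apply h (differentiableAt_const a)]
  simp

theorem fderiv_fderiv_comm {f : ℂ → ℂ} (hf : SmoothUH f) {z : ℂ} (hz : z ∈ UH) (a b : ℂ) :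
    fderiv ℝ (fun w => fderiv ℝ f w a) z b = fderiv ℝ (fun w => fderiv ℝ f w b) z a := by
  rw [fderiv_fderiv_apply hf hz, fderiv_fderiv_apply hf hz]
  have h2 : minSmoothness ℝ 2 ≤ ((⊤ : ℕ∞) : WithTop ℕ∞) := by
    rw [minSmoothness_of_isRCLikeNormedField]
    exact WithTop.coe_le_coe.mpr (le_top (a := (2 : ℕ∞)))
  exact (hf.contDiffAt (isOpen_UH.mem_nhds hz)).isSymmSndFDerivAt h2 b a

theorem wd_wd (c d : ℂ) {f : ℂ → ℂ} (hf : SmoothUH f) {z : ℂ} (hz : z ∈ UH) :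
    wd c (wd d f) z =
      dv (dv f) z + (c + d) * dv (du f) z + c * d * du (du f) z := by
  have hu : SmoothUH (du f) := hf.fderiv_apply 1
  have hv : SmoothUH (dv f) := hf.fderiv_apply Complex.I
  have h1 : wd c (wd d f) z = wd c (dv f) z + d * wd c (du f) z := by
    rw [← wd_const_mul c d hu hz, ← wd_add c hv (contDiffOn_const.mul hu) hz]
    rfl
  have h2 : du (dv f) z = dv (du f) z := fderiv_fderiv_comm hf hz _ _
  rw [h1]
  simp only [wd, h2]
  ring

theorem wd_comm (c d : ℂ) {f : ℂ → ℂ} (hf : SmoothUH f) {z : ℂ} (hz : z ∈ UH) :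
    wd c (wd d f) z = wd d (wd c f) z := by
  rw [wd_wd c d hf hz, wd_wd d c hf hz]
  ring

theorem wd_conj (c : ℂ) {f : ℂ → ℂ} (hf : SmoothUH f) {z : ℂ} (hz : z ∈ UH) :
    wd c (fun w => (starRingEnd ℂ) (f w)) z =
      (starRingEnd ℂ) (wd ((starRingEnd ℂ) c) f z) := by
  have h : HasFDerivAt (fun w => (starRingEnd ℂ) (f w))
      ((Complex.conjCLE : ℂ →L[ℝ] ℂ).comp (fderiv ℝ f z)) z :=
    (Complex.conjCLE : ℂ →L[ℝ] ℂ).hasFDerivAt.comp z (hf.differentiableAt hz).hasFDerivAt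
  simp [wd, du, dv, h.fderiv]

theorem two_I_mul_dtau (f : ℂ → ℂ) (z : ℂ) : 2 * Complex.I * dtau f z = wd Complex.I f z := by
  simp only [dtau, wd]
  linear_combination (-dv f z) * Complex.I_sq

theorem neg_two_I_mul_dtauBar (f : ℂ → ℂ) (z : ℂ) :
    -2 * Complex.I * dtauBar f z = wd (-Complex.I) f z := by
  simp only [dtauBar, wd]
  linear_combination (-dv f z) * Complex.I_sq

theorem SmoothUH.Rop {f : ℂ → ℂ} (hf : SmoothUH f) (k : ℤ) : SmoothUH (Rop k f) := by
  have h : _root_.Rop k f = fun z => _root_.wd Complex.I f z + ((k : ℂ) * (imC z)⁻¹) * f z := by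
    funext z
    rw [_root_.Rop, two_I_mul_dtau, imC, div_eq_mul_inv]
  rw [h]
  exact (hf.wd _).add
    ((contDiffOn_const.mul (smoothUH_imC.inv fun z hz => imC_ne_zero hz)).mul hf)

theorem SmoothUH.Riter {f : ℂ → ℂ} (hf : SmoothUH f) (k : ℤ) (r : ℕ) :
    SmoothUH (Riter k r f) := by
  induction r with
  | zero => exact hf
  | succ r ih => exact ih.Rop _

theorem imC_mul_Rop (k : ℤ) (f : ℂ → ℂ) {z : ℂ} (hz : z ∈ UH) :
    imC z * Rop k f z = imC z * wd Complex.I f z + k * f z := by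
  have := imC_ne_zero hz
  rw [Rop, two_I_mul_dtau]
  change imC z * (_ + (k : ℂ) / imC z * f z) = _
  field_simp

/-- The commutation relation between raising and lowering. -/
theorem imC_mul_wd_Rop (k : ℤ) {f : ℂ → ℂ} (hf : SmoothUH f) {z : ℂ} (hz : z ∈ UH) :
    Rop k f z + imC z * wd (-Complex.I) (Rop k f) z =
      wd Complex.I f z + imC z * wd Complex.I (wd (-Complex.I) f) z
        + k * wd (-Complex.I) f z := by
  have h := wd_congr (-Complex.I) (fun z hz => imC_mul_Rop k f hz) hz
  rw [wd_mul _ smoothUH_imC (hf.Rop k) hz,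
    wd_add _ (smoothUH_imC.mul (hf.wd _)) (contDiffOn_const.mul hf) hz,
    wd_mul _ smoothUH_imC (hf.wd _) hz, wd_const_mul _ _ hf hz, wd_imC,
    wd_comm (-Complex.I) Complex.I hf hz] at h
  linear_combination h

theorem lower_Riter {k : ℤ} {f : ℂ → ℂ} (hf : SmoothUH f) (hharm : ∀ z ∈ UH, Lap k f z = 0)
    (r : ℕ) : ∀ z ∈ UH,
      imC z ^ 2 * wd (-Complex.I) (Riter k (r + 1) f) z = (r + 1) * (-k - r) * Riter k r f z := by
  induction r with
  | zero =>
    intro z hz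
    have h1 := imC_mul_wd_Rop k hf hz
    have h2 := hharm z hz
    have h3 := imC_mul_Rop k f hz
    have h4 := wd_wd Complex.I (-Complex.I) hf hz
    have h5 : wd (-Complex.I) f z = dv f z - Complex.I * du f z := by simp only [wd]; ring
    change -imC z ^ 2 * _ + Complex.I * k * imC z * _ = 0 at h2
    have e : Riter k (0 + 1) f = Rop k f := by simp [Riter]
    rw [e]
    simp only [Riter]
    push_cast
    linear_combination imC z * h1 - h2 - h3 + imC z ^ 2 * h4 + imC z * k * h5
      + (imC z * k * dv f z - imC z ^ 2 * du (du f) z) * Complex.I_sq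
  | succ r ih =>
    intro z hz
    have hE := hf.Riter k r
    have hE' := hf.Riter k (r + 1)
    have h1 := imC_mul_wd_Rop (k + 2 * ((r + 1 : ℕ) : ℤ)) hE' hz
    have h2 := wd_congr Complex.I ih hz
    have h3 := imC_mul_Rop (k + 2 * (r : ℤ)) (Riter k r f) hz
    have h4 := imC_mul_Rop (k + 2 * ((r + 1 : ℕ) : ℤ)) (Riter k (r + 1) f) hz
    have h6 := ih z hz
    rw [wd_mul _ (smoothUH_imC.pow 2) (hE'.wd _) hz, wd_const_mul _ _ hE hz,
      wd_imC_pow _ 1 hz] at h2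
    change imC z * Riter k (r + 1) f z = _ at h3
    change imC z * Riter k (r + 1 + 1) f z = _ at h4
    change Riter k (r + 1 + 1) f z + imC z * wd _ (Riter k (r + 1 + 1) f) z = _ at h1
    have hv := imC_ne_zero hz
    push_cast at h1 h2 h3 h4 h6 ⊢
    apply mul_left_cancel₀ hv
    linear_combination imC z ^ 2 * h1 - imC z * h4 + imC z * h2 + (k + 2 * r) * h6
      - (r + 1) * (-k - r) * h3

theorem SmoothUH.iterate_wd {g : ℂ → ℂ} (hg : SmoothUH g) (c : ℂ) (n : ℕ) :
    SmoothUH ((_root_.wd c)^[n] g) := by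
  induction n with
  | zero => exact hg
  | succ n ih => rw [Function.iterate_succ_apply']; exact ih.wd c

theorem iterate_wd_const_mul (c a : ℂ) {g : ℂ → ℂ} (hg : SmoothUH g) (n : ℕ) :
    Set.EqOn ((wd c)^[n] fun w => a * g w) (fun w => a * (wd c)^[n] g w) UH := by
  induction n with
  | zero => exact fun _ _ => rfl
  | succ n ih =>
    intro z hz
    simp only [Function.iterate_succ_apply']
    rw [wd_congr c ih hz, wd_const_mul c a (hg.iterate_wd c n) hz]

theorem iterate_wd_imC_mul (c : ℂ) {g : ℂ → ℂ} (hg : SmoothUH g) (n : ℕ) :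
    Set.EqOn ((wd c)^[n + 1] fun w => imC w * g w)
      (fun w => imC w * (wd c)^[n + 1] g w + (n + 1) * (wd c)^[n] g w) UH := by
  induction n with
  | zero =>
    intro z hz
    simp only [zero_add, Function.iterate_one, Function.iterate_zero, id_eq]
    rw [wd_mul c smoothUH_imC hg hz, wd_imC]
    push_cast
    ring
  | succ n ih =>
    intro z hz
    have h1 := hg.iterate_wd c (n + 1)
    have h0 := hg.iterate_wd c n
    rw [Function.iterate_succ_apply', wd_congr c ih hz,
      wd_add c (smoothUH_imC.mul h1) (contDiffOn_const.mul h0) hz,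
      wd_mul c smoothUH_imC h1 hz, wd_const_mul c _ h0 hz, wd_imC,
      ← Function.iterate_succ_apply' (wd c), ← Function.iterate_succ_apply' (wd c)]
    push_cast
    ring

/-- The operator `v² (∂/∂v + c ∂/∂u)`. -/
def sqwd (c : ℂ) (f : ℂ → ℂ) (z : ℂ) : ℂ := imC z ^ 2 * wd c f z

theorem sqwd_congr (c : ℂ) {f g : ℂ → ℂ} (h : Set.EqOn f g UH) :
    Set.EqOn (sqwd c f) (sqwd c g) UH := fun z hz => by
  simp only [sqwd, wd_congr c h hz]

theorem SmoothUH.sqwd {f : ℂ → ℂ} (hf : SmoothUH f) (c : ℂ) : SmoothUH (sqwd c f) :=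
  (smoothUH_imC.pow 2).mul (hf.wd c)

theorem SmoothUH.iterate_sqwd {g : ℂ → ℂ} (hg : SmoothUH g) (c : ℂ) (n : ℕ) :
    SmoothUH ((_root_.sqwd c)^[n] g) := by
  induction n with
  | zero => exact hg
  | succ n ih => rw [Function.iterate_succ_apply']; exact ih.sqwd c

theorem iterate_sqwd_congr (c : ℂ) {f g : ℂ → ℂ} (h : Set.EqOn f g UH) (n : ℕ) :
    Set.EqOn ((sqwd c)^[n] f) ((sqwd c)^[n] g) UH := by
  induction n with
  | zero => exact h
  | succ n ih => simp only [Function.iterate_succ_apply']; exact sqwd_congr c ih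

theorem iterate_sqwd_const_mul (c a : ℂ) {g : ℂ → ℂ} (hg : SmoothUH g) (n : ℕ) :
    Set.EqOn ((sqwd c)^[n] fun w => a * g w) (fun w => a * (sqwd c)^[n] g w) UH := by
  induction n with
  | zero => exact fun _ _ => rfl
  | succ n ih =>
    intro z hz
    simp only [Function.iterate_succ_apply']
    rw [sqwd_congr c ih hz, sqwd, wd_const_mul c a (hg.iterate_sqwd c n) hz, sqwd]
    ring

/-- A form of Bol's identity: `v^{n+2} ∂^{n+1} v^n = (v² ∂)^{n+1}`. -/
theorem imC_pow_mul_iterate_wd (c : ℂ) {g : ℂ → ℂ} (hg : SmoothUH g) (n : ℕ) :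
    Set.EqOn (fun z => imC z ^ (n + 2) * (wd c)^[n + 1] (fun w => imC w ^ n * g w) z)
      ((sqwd c)^[n + 1] g) UH := by
  induction n with
  | zero => intro z _; simp [sqwd]
  | succ n ih =>
    intro z hz
    have hh : SmoothUH fun w => imC w ^ n * g w := (smoothUH_imC.pow n).mul hg
    have e : (fun w => imC w ^ (n + 1) * g w) = fun w => imC w * (imC w ^ n * g w) := by
      funext w; ring
    simp only []
    rw [e, iterate_wd_imC_mul c hh (n + 1) hz, Function.iterate_succ_apply' (sqwd c),
      ← sqwd_congr c ih hz, sqwd,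
      wd_mul c (smoothUH_imC.pow (n + 2)) (hh.iterate_wd c (n + 1)) hz,
      wd_imC_pow c (n + 1) hz, ← Function.iterate_succ_apply' (wd c)]
    push_cast
    ring

theorem sqwd_conj_Riter {m : ℕ} {f : ℂ → ℂ} (hf : SmoothUH f)
    (hharm : ∀ z ∈ UH, Lap (-(m : ℤ)) f z = 0) (r : ℕ) :
    Set.EqOn (sqwd Complex.I fun z => (starRingEnd ℂ) (Riter (-(m : ℤ)) (r + 1) f z))
      (fun z => (r + 1) * (m - r) * (starRingEnd ℂ) (Riter (-(m : ℤ)) r f z)) UH := by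
  intro z hz
  have h := congrArg (starRingEnd ℂ) (lower_Riter hf hharm r z hz)
  rw [sqwd, wd_conj _ (hf.Riter _ _) hz, Complex.conj_I]
  simpa [imC] using h

theorem iterate_sqwd_conj_Riter {m : ℕ} {f : ℂ → ℂ} (hf : SmoothUH f)
    (hharm : ∀ z ∈ UH, Lap (-(m : ℤ)) f z = 0) (r : ℕ) (hr : r ≤ m) :
    Set.EqOn ((sqwd Complex.I)^[r] fun z => (starRingEnd ℂ) (Riter (-(m : ℤ)) r f z))
      (fun z => (r.factorial * m.descFactorial r : ℂ) * (starRingEnd ℂ) (f z)) UH := by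
  induction r with
  | zero => intro z _; simp [Riter]
  | succ r ih =>
    intro z hz
    rw [Function.iterate_succ_apply,
      iterate_sqwd_congr _ (sqwd_conj_Riter hf hharm r) r hz,
      iterate_sqwd_const_mul _ _ (hf.Riter _ _).conj r hz]
    simp only []
    rw [ih (by omega) hz, Nat.factorial_succ, Nat.descFactorial_succ]
    push_cast [Nat.cast_sub (show r ≤ m by omega)]
    ring

theorem Dop_eq (g : ℂ → ℂ) (z : ℂ) :
    Dop g z = (-4 * (Real.pi : ℂ))⁻¹ * wd Complex.I g z := by
  have hpi : (Real.pi : ℂ) ≠ 0 := Complex.ofReal_ne_zero.mpr Real.pi_ne_zero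
  rw [Dop, ← two_I_mul_dtau]
  field_simp
  linear_combination (4 * dtau g z) * Complex.I_sq

theorem Diter_eq_s11 {g : ℂ → ℂ} (hg : SmoothUH g) (n : ℕ) :
    Set.EqOn (Diter n g)
      (fun z => ((-4 * (Real.pi : ℂ)) ^ n)⁻¹ * (wd Complex.I)^[n] g z) UH := by
  induction n with
  | zero => intro z _; simp [Diter]
  | succ n ih =>
    intro z hz
    simp only [Diter]
    rw [Dop_eq, wd_congr _ ih hz, wd_const_mul _ _ (hg.iterate_wd _ n) hz,
      Function.iterate_succ_apply', pow_succ, mul_inv]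
    ring

theorem Diter_flipOp {m : ℕ} {f : ℂ → ℂ} (hf : SmoothUH f)
    (hharm : ∀ z ∈ UH, Lap (-(m : ℤ)) f z = 0) {z : ℂ} (hz : z ∈ UH) :
    Diter (m + 1) (flipOp (-(m : ℤ)) f) z =
      ((m.factorial : ℂ) / (-4 * (Real.pi : ℂ)) ^ (m + 1)) * xiop (-(m : ℤ)) f z := by
  have hE : SmoothUH fun z => (starRingEnd ℂ) (Riter (-(m : ℤ)) m f z) := (hf.Riter _ _).conj
  have hVE : SmoothUH fun z => imC z ^ m * (starRingEnd ℂ) (Riter (-(m : ℤ)) m f z) :=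
    (smoothUH_imC.pow m).mul hE
  have e : flipOp (-(m : ℤ)) f = fun z => (m.factorial : ℂ)⁻¹ *
      (imC z ^ m * (starRingEnd ℂ) (Riter (-(m : ℤ)) m f z)) := by
    funext w
    simp only [flipOp, neg_neg, Int.toNat_natCast, zpow_natCast, imC]
    ring
  have hbol := imC_pow_mul_iterate_wd Complex.I hE m hz
  rw [Function.iterate_succ_apply' (sqwd Complex.I),
    sqwd_congr _ (iterate_sqwd_conj_Riter hf hharm m le_rfl) hz, sqwd,
    wd_const_mul _ _ hf.conj hz, wd_conj _ hf hz, Complex.conj_I,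
    ← neg_two_I_mul_dtauBar, Nat.descFactorial_self] at hbol
  simp only [map_mul, map_neg, Complex.conj_I, Complex.conj_ofNat] at hbol
  have hv := imC_ne_zero hz
  have hm : (m.factorial : ℂ) ≠ 0 := Nat.cast_ne_zero.mpr m.factorial_ne_zero
  have hpi : (-4 * (Real.pi : ℂ)) ^ (m + 1) ≠ 0 :=
    pow_ne_zero _ (mul_ne_zero (by norm_num) (Complex.ofReal_ne_zero.mpr Real.pi_ne_zero))
  rw [e, Diter_eq_s11 (contDiffOn_const.mul hVE) (m + 1) hz]
  simp only []
  rw [iterate_wd_const_mul _ _ hVE (m + 1) hz, xiop, zpow_neg, zpow_natCast]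
  change _ = _ * (2 * Complex.I * (imC z ^ m)⁻¹ * _)
  generalize (-4 * (Real.pi : ℂ)) ^ (m + 1) = p at hpi ⊢
  simp only []
  generalize (wd Complex.I)^[m + 1] _ z = X at hbol ⊢
  have hX : imC z ^ m * X =
      m.factorial * m.factorial * (2 * Complex.I * (starRingEnd ℂ) (dtauBar f z)) := by
    apply mul_left_cancel₀ (pow_ne_zero 2 hv)
    linear_combination hbol
  field_simp
  linear_combination hX

theorem dtauBar_eq_zero {f : ℂ → ℂ} {z : ℂ} (h : DifferentiableAt ℂ f z) :
    dtauBar f z = 0 := by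
  have e : fderiv ℝ f z Complex.I = Complex.I * fderiv ℝ f z 1 := by
    rw [h.fderiv_restrictScalars ℝ]
    simp
  rw [dtauBar, du, dv, e]
  linear_combination (1 / 2 * fderiv ℝ f z 1) * Complex.I_sq

/-- for `k ≤ 0` and `f` smooth with `Δ_k f = 0`,
`D^{1−k}(𝔉_k f) = ((−k)!/(−4π)^{1−k}) ξ_k f`; in particular if `f` is holomorphic
then `D^{1−k}(𝔉_k f) = 0`. -/
theorem stmt11 (k : ℤ) (hk : k ≤ 0) (f : ℂ → ℂ) (hf : ContDiffOn ℝ (⊤ : ℕ∞) f UH)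
    (hharm : ∀ z ∈ UH, Lap k f z = 0) :
    (∀ z ∈ UH,
      Diter (1 - k).toNat (flipOp k f) z
        = (((-k).toNat.factorial : ℂ) / (-4 * (Real.pi : ℂ)) ^ (1 - k)) * xiop k f z) ∧
    (DifferentiableOn ℂ f UH → ∀ z ∈ UH, Diter (1 - k).toNat (flipOp k f) z = 0) := by
  obtain ⟨m, rfl⟩ : ∃ m : ℕ, k = -(m : ℤ) := ⟨(-k).toNat, by omega⟩
  have h1 : (1 - -(m : ℤ)) = ((m + 1 : ℕ) : ℤ) := by push_cast; ring
  have key := fun (z : ℂ) (hz : z ∈ UH) => Diter_flipOp hf hharm hz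
  rw [h1, zpow_natCast, neg_neg, Int.toNat_natCast, Int.toNat_natCast]
  refine ⟨key, fun hd z hz => ?_⟩
  rw [key z hz, xiop, dtauBar_eq_zero (hd.differentiableAt (isOpen_UH.mem_nhds hz))]
  simp
end
end

section
/- Let k ∈ ℤ with k ≤ 0, let N be a positive integer, and let f : ℍ → ℂ be holomorphic with f(τ + 1/N) = f(τ) for all τ ∈ ℍ and with vanishing (1−k)-th complex derivative, i.e. ∂_τ^{1−k} f = 0 on ℍ. Then f is constant. Moreover, if in addition k < 0 and there exists γ = [[a,b],[c,d]] ∈ SL₂(ℤ) with c ≠ 0 such that f(γτ) = (cτ+d)^k f(τ) for all τ ∈ ℍ, then f is identically 0. -/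
open Complex

noncomputable section

theorem convex_UH : Convex ℝ UH :=
  convex_halfSpace_im_gt 0

theorem add_mem_UH_of_im_eq_zero {w : ℂ} (hw : w.im = 0) {z : ℂ} (hz : z ∈ UH) : z + w ∈ UH := by
  simpa [UH, hw] using hz

/-- A holomorphic function with vanishing derivative on the upper half-plane is constant. -/
theorem exists_eq_const_of_deriv_eq_zero {g : ℂ → ℂ} (hg : DifferentiableOn ℂ g UH)
    (hg' : ∀ z ∈ UH, deriv g z = 0) : ∃ c : ℂ, ∀ z ∈ UH, g z = c := by
  refine ⟨g I, fun z hz => ?_⟩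
  exact isOpen_UH.is_const_of_deriv_eq_zero convex_UH.isPreconnected hg hg' hz (by simp [UH])

/-- A holomorphic function on the upper half-plane with a nonzero real period and a vanishing
iterated derivative is constant. -/
theorem exists_eq_const_of_periodic_of_iterate_deriv_eq_zero {w : ℂ} (hw : w.im = 0) (hw0 : w ≠ 0)
    (n : ℕ) {f : ℂ → ℂ} (hf : DifferentiableOn ℂ f UH) (hper : ∀ z ∈ UH, f (z + w) = f z)
    (hder : ∀ z ∈ UH, (deriv^[n] f) z = 0) : ∃ c : ℂ, ∀ z ∈ UH, f z = c := by
  induction n generalizing f with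
  | zero => exact ⟨0, hder⟩
  | succ n ih =>
    have hper' : ∀ z ∈ UH, deriv f (z + w) = deriv f z := fun z hz => by
      rw [← deriv_comp_add_const]
      exact Filter.EventuallyEq.deriv_eq (Filter.eventuallyEq_of_mem (isOpen_UH.mem_nhds hz) hper)
    obtain ⟨c, hc⟩ := ih (hf.deriv isOpen_UH) hper' hder
    obtain ⟨d, hd⟩ := exists_eq_const_of_deriv_eq_zero (g := fun z => f z - c * z)
      (hf.sub (by fun_prop)) fun z hz => by
        have hfz := (hf.differentiableAt (isOpen_UH.mem_nhds hz)).hasDerivAt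
        refine (hfz.sub ((hasDerivAt_id z).const_mul c)).deriv.trans ?_
        simp [hc z hz]
    have hI : I ∈ UH := by simp [UH]
    have h₁ := hd _ hI
    have h₂ := hd _ (add_mem_UH_of_im_eq_zero hw hI)
    have hcw : c * w = 0 := by linear_combination h₁ - h₂ + hper I hI
    have hc0 : c = 0 := (mul_eq_zero.mp hcw).resolve_right hw0
    exact ⟨d, fun z hz => by simpa [hc0] using hd z hz⟩

/-- Integral Möbius transformations of determinant one preserve the upper half-plane. -/
theorem moebius_mem_UH (γ : Matrix.SpecialLinearGroup (Fin 2) ℤ) {z : ℂ} (hz : z ∈ UH) :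
    ((γ.1 0 0 : ℂ) * z + (γ.1 0 1 : ℂ)) / ((γ.1 1 0 : ℂ) * z + (γ.1 1 1 : ℂ)) ∈ UH := by
  have h := UpperHalfPlane.specialLinearGroup_apply γ ⟨z, hz⟩
  have him := (γ • (⟨z, hz⟩ : UpperHalfPlane)).im_pos
  rw [h] at him
  simpa [UH] using him

/-- The automorphy factor `cz + d` has norm greater than one at `z = 2i` when `c ≠ 0`. -/
theorem one_lt_norm_two_I_mul_add {c : ℤ} (hc : c ≠ 0) (d : ℤ) :
    1 < ‖(c : ℂ) * (2 * I) + d‖ := by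
  have h := Complex.abs_im_le_norm ((c : ℂ) * (2 * I) + d)
  have hc' : (1 : ℝ) ≤ |(c : ℝ)| := by exact_mod_cast Int.one_le_abs hc
  simp [abs_mul] at h
  linarith

/-- a holomorphic function on the upper half-plane, invariant under
`τ ↦ τ + 1/N` and with vanishing `(1−k)`-th complex derivative (`k ≤ 0`), is constant;
if moreover `k < 0` and `f` transforms with weight `k` under some `γ ∈ SL₂(ℤ)` with
`c ≠ 0`, then `f` is identically `0`. -/
theorem stmt12 (k : ℤ) (hk : k ≤ 0) (N : ℕ) (hN : 0 < N) (f : ℂ → ℂ)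
    (hf : DifferentiableOn ℂ f UH)
    (hper : ∀ z ∈ UH, f (z + 1 / (N : ℂ)) = f z)
    (hder : ∀ z ∈ UH, (deriv^[(1 - k).toNat] f) z = 0) :
    (∃ c : ℂ, ∀ z ∈ UH, f z = c) ∧
    (k < 0 →
      (∃ γ : Matrix.SpecialLinearGroup (Fin 2) ℤ, ((γ.1 1 0 : ℂ) ≠ 0) ∧
        ∀ z ∈ UH,
          f (((γ.1 0 0 : ℂ) * z + (γ.1 0 1 : ℂ)) / ((γ.1 1 0 : ℂ) * z + (γ.1 1 1 : ℂ)))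
            = ((γ.1 1 0 : ℂ) * z + (γ.1 1 1 : ℂ)) ^ k * f z) →
      ∀ z ∈ UH, f z = 0) := by
  have hN' : (N : ℂ) ≠ 0 := by exact_mod_cast hN.ne'
  obtain ⟨C, hC⟩ := exists_eq_const_of_periodic_of_iterate_deriv_eq_zero (w := 1 / (N : ℂ))
    (by simp) (one_div_ne_zero hN') _ hf hper hder
  refine ⟨⟨C, hC⟩, ?_⟩
  rintro hk' ⟨γ, hc, hγ⟩ z hz
  have hI : 2 * I ∈ UH := by simp [UH]
  have h := hγ _ hI
  rw [hC _ (moebius_mem_UH γ hI), hC _ hI] at h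
  rw [hC z hz]
  by_contra hC0
  have hone := (mul_eq_right₀ hC0).mp h.symm
  have hlt := zpow_lt_one_of_neg₀ (one_lt_norm_two_I_mul_add (by exact_mod_cast hc) (γ.1 1 1)) hk'
  rw [← norm_zpow, hone, norm_one] at hlt
  exact lt_irrefl _ hlt
end
end

section
/- Let m ∈ ℕ. The 𝒫_m-valued functions e_{r,m−r} (of weight m−2r) satisfy, with the Maass operators acting coefficientwise: L_{m−2r} e_{r,m−r} = (r+1)(m−r) · e_{r+1,m−r−1} for 0 ≤ r ≤ m−1, and L_{−m} e_{m,0} = 0; likewise R_{m−2r} e_{r,m−r} = e_{r−1,m−r+1} for 1 ≤ r ≤ m, and R_m e_{0,m} = 0. -/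
open Complex

noncomputable section

/-- The `𝒫_m`-valued function
`e_{r,m−r}(τ)(X) = ((−1)^{m−r}/r!) v^{r−m} (X−τ)^r (X−conj(τ))^{m−r}`,
as a polynomial in `X`. -/
noncomputable def epoly (m r : ℕ) (τ : ℂ) : Polynomial ℂ :=
  Polynomial.C ((-1 : ℂ) ^ (m - r) / (r.factorial : ℂ) * (τ.im : ℂ) ^ ((r : ℤ) - (m : ℤ))) *
    (Polynomial.X - Polynomial.C τ) ^ r *
    (Polynomial.X - Polynomial.C ((starRingEnd ℂ) τ)) ^ (m - r)

/-- The real-linear map `w ↦ a w + b w̄`. -/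
def wirtingerCLM (a b : ℂ) : ℂ →L[ℝ] ℂ :=
  a • ContinuousLinearMap.id ℝ ℂ + b • (Complex.conjCLE : ℂ →L[ℝ] ℂ)

lemma wirtingerCLM_apply (a b w : ℂ) :
    wirtingerCLM a b w = a * w + b * (starRingEnd ℂ) w := by
  simp [wirtingerCLM]

/-- The polynomial-valued function `P` is coefficientwise real-differentiable at `z`, with
Wirtinger derivatives `A` (in `τ`) and `B` (in `τ̄`). -/
def HasWirtingerAt (P : ℂ → Polynomial ℂ) (A B : Polynomial ℂ) (z : ℂ) : Prop :=
  ∀ j, HasFDerivAt (fun w => (P w).coeff j) (wirtingerCLM (A.coeff j) (B.coeff j)) z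

lemma dtau_eq_of_hasFDerivAt {f : ℂ → ℂ} {a b z : ℂ}
    (h : HasFDerivAt f (wirtingerCLM a b) z) : dtau f z = a := by
  simp only [dtau, du, dv, h.fderiv, wirtingerCLM_apply, map_one, conj_I]
  linear_combination (-(a - b) / 2) * I_mul_I

lemma dtauBar_eq_of_hasFDerivAt {f : ℂ → ℂ} {a b z : ℂ}
    (h : HasFDerivAt f (wirtingerCLM a b) z) : dtauBar f z = b := by
  simp only [dtauBar, du, dv, h.fderiv, wirtingerCLM_apply, map_one, conj_I]
  linear_combination ((a - b) / 2) * I_mul_I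

lemma HasWirtingerAt.congr {P : ℂ → Polynomial ℂ} {A B A' B' : Polynomial ℂ} {z : ℂ}
    (h : HasWirtingerAt P A B z) (hA : A = A') (hB : B = B') : HasWirtingerAt P A' B' z := by
  subst hA hB
  exact h

lemma HasWirtingerAt.mul {P Q : ℂ → Polynomial ℂ} {A B A' B' : Polynomial ℂ} {z : ℂ}
    (hP : HasWirtingerAt P A B z) (hQ : HasWirtingerAt Q A' B' z) :
    HasWirtingerAt (fun w => P w * Q w) (A * Q z + P z * A') (B * Q z + P z * B') z := by
  intro j
  simp only [Polynomial.coeff_mul]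
  refine (HasFDerivAt.fun_sum fun x _ => (hP x.1).mul (hQ x.2)).congr_fderiv ?_
  ext w
  simp only [sum_apply, _root_.add_apply,
    smul_apply, wirtingerCLM_apply, Polynomial.coeff_add,
    Polynomial.coeff_mul, smul_eq_mul, Finset.sum_mul, add_mul, ← Finset.sum_add_distrib]
  refine Finset.sum_congr rfl fun x _ => ?_
  ring

lemma HasWirtingerAt.pow {P : ℂ → Polynomial ℂ} {A B : Polynomial ℂ} {z : ℂ}
    (hP : HasWirtingerAt P A B z) (n : ℕ) :
    HasWirtingerAt (fun w => P w ^ n) (n * P z ^ (n - 1) * A) (n * P z ^ (n - 1) * B) z := by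
  induction n with
  | zero =>
    intro j
    simp only [pow_zero]
    exact (hasFDerivAt_const _ z).congr_fderiv (by ext w; simp [wirtingerCLM_apply])
  | succ n ih =>
    simp only [pow_succ]
    refine (ih.mul hP).congr ?_ ?_ <;>
    · rcases n with _ | n
      · simp
      · simp only [Nat.add_sub_cancel]
        push_cast
        ring

lemma hasWirtingerAt_C {f : ℂ → ℂ} {a b z : ℂ} (h : HasFDerivAt f (wirtingerCLM a b) z) :
    HasWirtingerAt (fun w => Polynomial.C (f w)) (Polynomial.C a) (Polynomial.C b) z := by
  intro j
  simp only [Polynomial.coeff_C]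
  split_ifs
  · exact h
  · exact (hasFDerivAt_const _ z).congr_fderiv (by ext w; simp [wirtingerCLM_apply])

lemma hasWirtingerAt_X_sub_C {f : ℂ → ℂ} {a b z : ℂ} (h : HasFDerivAt f (wirtingerCLM a b) z) :
    HasWirtingerAt (fun w => Polynomial.X - Polynomial.C (f w))
      (-Polynomial.C a) (-Polynomial.C b) z := by
  intro j
  simp only [Polynomial.coeff_sub]
  refine (((hasWirtingerAt_C h) j).const_sub _).congr_fderiv ?_
  ext w
  simp only [neg_apply, wirtingerCLM_apply, Polynomial.coeff_neg]
  ring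

lemma hasFDerivAt_id_wirtinger (z : ℂ) : HasFDerivAt (fun w : ℂ => w) (wirtingerCLM 1 0) z :=
  (hasFDerivAt_id z).congr_fderiv (by ext w; simp [wirtingerCLM_apply])

lemma hasFDerivAt_conj_wirtinger (z : ℂ) :
    HasFDerivAt (fun w : ℂ => (starRingEnd ℂ) w) (wirtingerCLM 0 1) z :=
  (Complex.conjCLE : ℂ →L[ℝ] ℂ).hasFDerivAt.congr_fderiv (by ext w; simp [wirtingerCLM_apply])

lemma hasFDerivAt_im_wirtinger (z : ℂ) :
    HasFDerivAt (fun w : ℂ => (w.im : ℂ)) (wirtingerCLM (-I / 2) (I / 2)) z :=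
  (Complex.ofRealCLM.comp Complex.imCLM).hasFDerivAt.congr_fderiv <| by
    ext w
    simp only [wirtingerCLM_apply, ContinuousLinearMap.comp_apply, imCLM_apply, ofRealCLM_apply]
    apply Complex.ext <;> simp <;> ring

lemma hasFDerivAt_im_zpow_wirtinger (c : ℂ) (k : ℤ) {z : ℂ} (hz : z.im ≠ 0) :
    HasFDerivAt (fun w : ℂ => c * (w.im : ℂ) ^ k)
      (wirtingerCLM (c * (k * (z.im : ℂ) ^ (k - 1)) * (-I / 2))
        (c * (k * (z.im : ℂ) ^ (k - 1)) * (I / 2))) z := by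
  have h := ((hasDerivAt_zpow k (z.im : ℂ) (Or.inl (by exact_mod_cast hz))).const_mul
    c).comp_hasFDerivAt_of_eq z (hasFDerivAt_im_wirtinger z) rfl
  refine h.congr_fderiv ?_
  ext w
  simp only [smul_apply, wirtingerCLM_apply, smul_eq_mul]
  ring

/-- The Wirtinger derivatives of `epoly`. -/
lemma hasWirtingerAt_epoly (r n : ℕ) {z : ℂ} (hz : z.im ≠ 0) :
    HasWirtingerAt (epoly (r + n) r)
      (Polynomial.C ((-1 : ℂ) ^ n / r.factorial) *
        (Polynomial.C (n * (z.im : ℂ) ^ (-(n : ℤ) - 1) * (I / 2)) *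
            (Polynomial.X - Polynomial.C z) ^ r
          - Polynomial.C (r * (z.im : ℂ) ^ (-(n : ℤ))) *
            (Polynomial.X - Polynomial.C z) ^ (r - 1)) *
        (Polynomial.X - Polynomial.C ((starRingEnd ℂ) z)) ^ n)
      (-Polynomial.C ((-1 : ℂ) ^ n / r.factorial) *
        (Polynomial.X - Polynomial.C z) ^ r *
        (Polynomial.C (n * (z.im : ℂ) ^ (-(n : ℤ) - 1) * (I / 2)) *
            (Polynomial.X - Polynomial.C ((starRingEnd ℂ) z)) ^ n
          + Polynomial.C (n * (z.im : ℂ) ^ (-(n : ℤ))) *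
            (Polynomial.X - Polynomial.C ((starRingEnd ℂ) z)) ^ (n - 1))) z := by
  have hk : (r : ℤ) - ((r + n : ℕ) : ℤ) = -n := by push_cast; ring
  have h := ((hasWirtingerAt_C (hasFDerivAt_im_zpow_wirtinger
    ((-1 : ℂ) ^ n / r.factorial) (-n) hz)).mul
    ((hasWirtingerAt_X_sub_C (hasFDerivAt_id_wirtinger z)).pow r)).mul
    ((hasWirtingerAt_X_sub_C (hasFDerivAt_conj_wirtinger z)).pow n)
  unfold epoly
  simp only [hk, Nat.add_sub_cancel_left]
  refine h.congr ?_ ?_ <;>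
  · apply Polynomial.funext
    intro x
    simp only [Polynomial.eval_mul, Polynomial.eval_add, Polynomial.eval_sub, Polynomial.eval_neg,
      Polynomial.eval_pow, Polynomial.eval_C, Polynomial.eval_X, Polynomial.eval_natCast]
    push_cast
    ring

lemma conj_eq_sub_two_I_mul_im (z : ℂ) : (starRingEnd ℂ) z = z - 2 * I * z.im := by
  apply Complex.ext <;> simp
  ring

lemma Lop_coeff {P : ℂ → Polynomial ℂ} {A B : Polynomial ℂ} {z : ℂ}
    (h : HasWirtingerAt P A B z) (k : ℤ) (j : ℕ) :
    Lop k (fun w => (P w).coeff j) z =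
      (Polynomial.C (-2 * I * (z.im : ℂ) ^ 2) * B).coeff j := by
  rw [Lop, dtauBar_eq_of_hasFDerivAt (h j), Polynomial.coeff_C_mul]

lemma Rop_coeff {P : ℂ → Polynomial ℂ} {A B : Polynomial ℂ} {z : ℂ}
    (h : HasWirtingerAt P A B z) (k : ℤ) (j : ℕ) :
    Rop k (fun w => (P w).coeff j) z =
      (Polynomial.C (2 * I) * A + Polynomial.C ((k : ℂ) / (z.im : ℂ)) * P z).coeff j := by
  rw [Rop, dtau_eq_of_hasFDerivAt (h j), Polynomial.coeff_add, Polynomial.coeff_C_mul,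
    Polynomial.coeff_C_mul]

/-- with the Maass operators acting coefficientwise,
`L_{m−2r} e_{r,m−r} = (r+1)(m−r) e_{r+1,m−r−1}` for `0 ≤ r ≤ m−1`, `L_{−m} e_{m,0} = 0`,
`R_{m−2r} e_{r,m−r} = e_{r−1,m−r+1}` for `1 ≤ r ≤ m`, and `R_m e_{0,m} = 0`. -/
theorem stmt14 (m : ℕ) :
    (∀ r : ℕ, r < m → ∀ j : ℕ, ∀ τ ∈ UH,
      Lop ((m : ℤ) - 2 * (r : ℤ)) (fun z => (epoly m r z).coeff j) τ
        = (((r : ℂ) + 1) * ((m : ℂ) - (r : ℂ))) * (epoly m (r + 1) τ).coeff j) ∧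
    (∀ j : ℕ, ∀ τ ∈ UH,
      Lop (-(m : ℤ)) (fun z => (epoly m m z).coeff j) τ = 0) ∧
    (∀ r : ℕ, 1 ≤ r → r ≤ m → ∀ j : ℕ, ∀ τ ∈ UH,
      Rop ((m : ℤ) - 2 * (r : ℤ)) (fun z => (epoly m r z).coeff j) τ
        = (epoly m (r - 1) τ).coeff j) ∧
    (∀ j : ℕ, ∀ τ ∈ UH,
      Rop (m : ℤ) (fun z => (epoly m 0 z).coeff j) τ = 0) := by
  refine ⟨fun r hr j τ hτ => ?_, fun j τ hτ => ?_, fun r hr1 hrm j τ hτ => ?_,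
    fun j τ hτ => ?_⟩
  all_goals
    have him : τ.im ≠ 0 := ne_of_gt hτ
    have hv : (τ.im : ℂ) ≠ 0 := by exact_mod_cast him
  · obtain ⟨n, rfl⟩ : ∃ n, m = r + (n + 1) := ⟨m - r - 1, by omega⟩
    have hf : (r.factorial : ℂ) ≠ 0 := by exact_mod_cast r.factorial_ne_zero
    have hr' : (r : ℂ) + 1 ≠ 0 := by exact_mod_cast r.succ_ne_zero
    have hk : ((r + 1 : ℕ) : ℤ) - ((r + (n + 1) : ℕ) : ℤ) = -n := by push_cast; ring
    have hn : r + (n + 1) - (r + 1) = n := by omega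
    have e1 : (τ.im : ℂ) ^ (-((n + 1 : ℕ) : ℤ)) = ((τ.im : ℂ) ^ (n + 1))⁻¹ := by
      rw [zpow_neg, zpow_natCast]
    have e2 : (τ.im : ℂ) ^ (-((n + 1 : ℕ) : ℤ) - 1) = ((τ.im : ℂ) ^ (n + 2))⁻¹ := by
      rw [← zpow_natCast, ← zpow_neg]; congr 1
    rw [Lop_coeff (hasWirtingerAt_epoly r (n + 1) him), ← Polynomial.coeff_C_mul]
    congr 1
    unfold epoly
    rw [hk, hn, e1, e2, zpow_neg, zpow_natCast, Nat.factorial_succ]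
    apply Polynomial.funext
    intro x
    simp only [Polynomial.eval_mul, Polynomial.eval_add, Polynomial.eval_sub, Polynomial.eval_neg,
      Polynomial.eval_pow, Polynomial.eval_C, Polynomial.eval_X, conj_eq_sub_two_I_mul_im,
      Nat.add_sub_cancel]
    push_cast
    field_simp
    ring_nf
    simp only [I_sq, I_pow_three]
    ring
  · have h := hasWirtingerAt_epoly m 0 him
    rw [add_zero] at h
    rw [Lop_coeff h]
    simp
  · obtain ⟨n, rfl⟩ : ∃ n, m = r + n := ⟨m - r, by omega⟩
    obtain ⟨r, rfl⟩ : ∃ s, r = s + 1 := ⟨r - 1, by omega⟩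
    have hf : (r.factorial : ℂ) ≠ 0 := by exact_mod_cast r.factorial_ne_zero
    have hr' : (r : ℂ) + 1 ≠ 0 := by exact_mod_cast r.succ_ne_zero
    have hk : ((r + 1 : ℕ) : ℤ) - ((r + 1 + n : ℕ) : ℤ) = -n := by push_cast; ring
    have hk' : (r : ℤ) - ((r + 1 + n : ℕ) : ℤ) = -((n + 1 : ℕ) : ℤ) := by push_cast; ring
    have hn : r + 1 + n - r = n + 1 := by omega
    have e2 : (τ.im : ℂ) ^ (-(n : ℤ) - 1) = ((τ.im : ℂ) ^ (n + 1))⁻¹ := by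
      rw [← zpow_natCast, ← zpow_neg]; congr 1; omega
    rw [Rop_coeff (hasWirtingerAt_epoly (r + 1) n him)]
    congr 1
    unfold epoly
    rw [Nat.add_sub_cancel, Nat.add_sub_cancel_left, hk, hk', hn, e2, zpow_neg, zpow_natCast,
      zpow_neg, zpow_natCast, Nat.factorial_succ]
    apply Polynomial.funext
    intro x
    simp only [Polynomial.eval_mul, Polynomial.eval_add, Polynomial.eval_sub,
      Polynomial.eval_pow, Polynomial.eval_C, Polynomial.eval_X, conj_eq_sub_two_I_mul_im]
    push_cast
    field_simp
    ring_nf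
    simp only [I_sq]
    ring
  · have e2 : (τ.im : ℂ) ^ (-(m : ℤ) - 1) = ((τ.im : ℂ) ^ (m + 1))⁻¹ := by
      rw [← zpow_natCast, ← zpow_neg]; congr 1; omega
    have h := hasWirtingerAt_epoly 0 m him
    rw [zero_add] at h
    rw [Rop_coeff h]
    have hk : ((0 : ℕ) : ℤ) - (m : ℤ) = -m := by simp
    convert Polynomial.coeff_zero j
    unfold epoly
    rw [e2, hk, zpow_neg, zpow_natCast]
    apply Polynomial.funext
    intro x
    simp
    field_simp
    ring_nf
    simp only [I_sq]
    ring
end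
end
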